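/- Universal quantum masking is impossible without quantum correlation: let d ≥ 2. There do not exist a unitary M from ℂ^d⊗ℂ^s to ℂ^{d_A}⊗ℂ^{d_B}, a density matrix ω on ℂ^s, and orthonormal bases {f_i} of ℂ^{d_A} and {e_j} of ℂ^{d_B} such that (M, ω) is a universal quantum masker for d-dimensional states and, for every density matrix ρ on ℂ^d, the masked state is classically correlated, i.e. Φ(ρ) = M(ρ⊗ω)M† = ∑_{i,j} p_{ij}(ρ) |f_i⟩⟨f_i|⊗|e_j⟩⟨e_j| for some nonnegative coefficients p_{ij}(ρ). -/

import Mathlib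

open Matrix Kronecker
open scoped ComplexOrder

noncomputable section

/-- A density matrix: positive semidefinite with trace 1. -/
def IsDensity {n : Type*} [Fintype n] (ρ : Matrix n n ℂ) : Prop :=
  ρ.PosSemidef ∧ ρ.trace = 1

/-- The outer product `|v⟩⟨v|`. -/
def outer {n : Type*} (v : n → ℂ) : Matrix n n ℂ :=
  Matrix.of fun i j => v i * (starRingEnd ℂ) (v j)

/-- Partial trace over the second tensor factor. -/
def ptrace2 {m n : Type*} [Fintype n] (M : Matrix (m × n) (m × n) ℂ) :
    Matrix m m ℂ := Matrix.of fun i i' => ∑ j, M (i, j) (i', j)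

/-- Partial trace over the first tensor factor. -/
def ptrace1 {m n : Type*} [Fintype m] (M : Matrix (m × n) (m × n) ℂ) :
    Matrix n n ℂ := Matrix.of fun j j' => ∑ i, M (i, j) (i, j')

/-- `(M, ω)` is a universal quantum masker for `d`-dimensional states:
`M` is a unitary from `ℂ^d ⊗ ℂ^s` to `ℂ^{dA} ⊗ ℂ^{dB}`, `ω` is a density matrix on `ℂ^s`,
and both marginals of `Φ(ρ) = M (ρ ⊗ ω) M†` are independent of the input density matrix `ρ`. -/
def IsMasker (d s dA dB : ℕ) (M : Matrix (Fin dA × Fin dB) (Fin d × Fin s) ℂ)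
    (ω : Matrix (Fin s) (Fin s) ℂ) : Prop :=
  Mᴴ * M = 1 ∧ M * Mᴴ = 1 ∧ IsDensity ω ∧
  ∃ (σA : Matrix (Fin dA) (Fin dA) ℂ) (σB : Matrix (Fin dB) (Fin dB) ℂ),
    IsDensity σA ∧ IsDensity σB ∧
    ∀ ρ : Matrix (Fin d) (Fin d) ℂ, IsDensity ρ →
      ptrace2 (M * (ρ ⊗ₖ ω) * Mᴴ) = σA ∧ ptrace1 (M * (ρ ⊗ₖ ω) * Mᴴ) = σB

/-- Von Neumann entropy in bits: `-∑ λ log₂ λ` over the eigenvalues. -/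
def vNEntropy {n : Type*} [Fintype n] [DecidableEq n] (ρ : Matrix n n ℂ) : ℝ :=
  if h : ρ.IsHermitian then -∑ i, h.eigenvalues i * Real.logb 2 (h.eigenvalues i)
  else 0

theorem outer_eq_vecMulVec {n : Type*} (v : n → ℂ) : outer v = vecMulVec v (star v) := rfl

theorem isDensity_outer {n : Type*} [Fintype n] {v : n → ℂ} (hv : star v ⬝ᵥ v = 1) :
    IsDensity (outer v) := by
  rw [outer_eq_vecMulVec]
  refine ⟨posSemidef_vecMulVec_self_star v, ?_⟩
  rw [trace_vecMulVec, dotProduct_comm, hv]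

theorem commute_outer_of_orthonormal {n ι : Type*} [Fintype n] [DecidableEq ι] {f : ι → n → ℂ}
    (hf : ∀ i j, star (f i) ⬝ᵥ f j = if i = j then 1 else 0) (i j : ι) :
    Commute (outer (f i)) (outer (f j)) := by
  rcases eq_or_ne i j with rfl | hij
  · exact Commute.refl _
  · simp [Commute, SemiconjBy, outer_eq_vecMulVec, vecMulVec_mul_vecMulVec, hf, hij, hij.symm]

theorem commute_kronecker {m n : Type*} [Fintype m] [Fintype n] {A A' : Matrix m m ℂ}
    {B B' : Matrix n n ℂ} (hA : Commute A A') (hB : Commute B B') :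
    Commute (A ⊗ₖ B) (A' ⊗ₖ B') := by
  rw [Commute, SemiconjBy, ← mul_kronecker_mul, ← mul_kronecker_mul, hA.eq, hB.eq]

theorem commute_of_isometry_conj {m n : Type*} [Fintype m] [Fintype n] [DecidableEq n]
    {M : Matrix m n ℂ} (hM : Mᴴ * M = 1) {X Y : Matrix n n ℂ}
    (h : Commute (M * X * Mᴴ) (M * Y * Mᴴ)) : Commute X Y := by
  have key : ∀ A B : Matrix n n ℂ, Mᴴ * (M * A * Mᴴ * (M * B * Mᴴ)) * M = A * B := by
    intro A B
    calc Mᴴ * (M * A * Mᴴ * (M * B * Mᴴ)) * M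
        = (Mᴴ * M) * A * (Mᴴ * M) * B * (Mᴴ * M) := by simp only [Matrix.mul_assoc]
      _ = A * B := by simp [hM]
  rw [Commute, SemiconjBy, ← key X Y, h.eq, key]

theorem commute_of_commute_kronecker_density {m n : Type*} [Fintype m] [Fintype n]
    {ω : Matrix n n ℂ} (hω : IsDensity ω) {A B : Matrix m m ℂ}
    (h : Commute (A ⊗ₖ ω) (B ⊗ₖ ω)) : Commute A B := by
  have hne : ω * ω ≠ 0 := by
    intro h0
    have hz : ω = 0 := by
      rw [← conjTranspose_mul_self_eq_zero, hω.1.isHermitian.eq, h0]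
    simpa [hz] using hω.2
  obtain ⟨a, b, hab⟩ : ∃ a b, (ω * ω) a b ≠ 0 := by
    by_contra! hall
    exact hne (Matrix.ext hall)
  have hk : (A * B) ⊗ₖ (ω * ω) = (B * A) ⊗ₖ (ω * ω) := by
    rw [mul_kronecker_mul, mul_kronecker_mul, h.eq]
  ext i j
  have := congrFun (congrFun hk (i, a)) (j, b)
  simpa [kronecker_apply, hab] using this

theorem exists_noncommuting_densities {n : Type*} [Fintype n] [DecidableEq n] [Nontrivial n] :
    ∃ A B : Matrix n n ℂ, IsDensity A ∧ IsDensity B ∧ ¬ Commute A B := by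
  obtain ⟨x, y, hxy⟩ := exists_pair_ne n
  refine ⟨outer (Pi.single x 1), outer (Pi.single x (3 / 5) + Pi.single y (4 / 5)),
    isDensity_outer ?_, isDensity_outer ?_, fun h => ?_⟩
  · simp
  · simp [dotProduct_add, hxy, hxy.symm]
    norm_num
  · have := congrFun (congrFun h.eq x) y
    simp [outer_eq_vecMulVec, vecMulVec_mul_vecMulVec, vecMulVec_apply, dotProduct_add,
      hxy, hxy.symm] at this

/-- universal quantum masking is impossible without quantum correlation:
no universal quantum masker outputs only classically correlated states. -/
theorem no_classically_correlated_masking (d : ℕ) (hd : 2 ≤ d) :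
    ¬ ∃ (s dA dB : ℕ) (_ : 0 < s) (_ : 0 < dA) (_ : 0 < dB) (_ : d * s = dA * dB)
      (M : Matrix (Fin dA × Fin dB) (Fin d × Fin s) ℂ)
      (ω : Matrix (Fin s) (Fin s) ℂ)
      (f : Fin dA → (Fin dA → ℂ)) (e : Fin dB → (Fin dB → ℂ)),
      IsMasker d s dA dB M ω ∧
      (∀ i j, star (f i) ⬝ᵥ f j = if i = j then 1 else 0) ∧
      (∀ i j, star (e i) ⬝ᵥ e j = if i = j then 1 else 0) ∧
      Submodule.span ℂ (Set.range f) = ⊤ ∧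
      Submodule.span ℂ (Set.range e) = ⊤ ∧
      ∀ ρ : Matrix (Fin d) (Fin d) ℂ, IsDensity ρ →
        ∃ p : Fin dA → Fin dB → ℝ, (∀ i j, 0 ≤ p i j) ∧
          M * (ρ ⊗ₖ ω) * Mᴴ = ∑ i, ∑ j, (p i j : ℂ) • (outer (f i) ⊗ₖ outer (e j)) := by
  rintro ⟨s, dA, dB, -, -, -, -, M, ω, f, e, ⟨hM, -, hω, -⟩, hf, he, -, -, hΦ⟩
  have : Nontrivial (Fin d) := Fin.nontrivial_iff_two_le.mpr hd
  obtain ⟨A, B, hA, hB, hAB⟩ := exists_noncommuting_densities (n := Fin d)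
  obtain ⟨p, -, hp⟩ := hΦ A hA
  obtain ⟨q, -, hq⟩ := hΦ B hB
  refine hAB (commute_of_commute_kronecker_density hω (commute_of_isometry_conj hM ?_))
  rw [hp, hq]
  refine Commute.sum_left _ _ _ fun i _ => Commute.sum_left _ _ _ fun j _ =>
    Commute.sum_right _ _ _ fun k _ => Commute.sum_right _ _ _ fun l _ => ?_
  exact ((commute_kronecker (commute_outer_of_orthonormal hf i k)
    (commute_outer_of_orthonormal he j l)).smul_left _).smul_right _

end
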